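/- For every n ≥ 9, there exists a planar graph on n vertices that contains no induced copy of P_5 and has exactly ⌊11n/4⌋ − 4 edges. -/

import Mathlib

open SimpleGraph

/-- `G` contains a subdivision of `H`, i.e. `H` is a topological minor of `G`:
there are branch vertices given by an injection `f` and, for each edge of `H`,
a path in `G` between the corresponding branch vertices, such that these paths
are internally disjoint from each other and from the branch vertices. -/
def ContainsSubdivision {W V : Type*} (H : SimpleGraph W) (G : SimpleGraph V) : Prop :=
  ∃ (f : W ↪ V) (p : ∀ ⦃a b : W⦄, H.Adj a b → G.Walk (f a) (f b)),
    (∀ ⦃a b : W⦄ (h : H.Adj a b), (p h).IsPath) ∧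
    (∀ ⦃a b : W⦄ (h : H.Adj a b) (w : W), f w ∈ (p h).support → w = a ∨ w = b) ∧
    (∀ ⦃a b c d : W⦄ (h₁ : H.Adj a b) (h₂ : H.Adj c d), s(a, b) ≠ s(c, d) →
      ∀ x, x ∈ (p h₁).support → x ∈ (p h₂).support →
        (x = f a ∨ x = f b) ∧ (x = f c ∨ x = f d))

/-- A graph is planar iff it contains no subdivision of `K₅` or of `K₃,₃`
(Kuratowski's characterization). -/
def IsPlanar {V : Type*} (G : SimpleGraph V) : Prop :=
  ¬ ContainsSubdivision (completeGraph (Fin 5)) G ∧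
  ¬ ContainsSubdivision (completeBipartiteGraph (Fin 3) (Fin 3)) G

/-- `G` contains an induced copy of `F`. -/
def ContainsInduced {W V : Type*} (F : SimpleGraph W) (G : SimpleGraph V) : Prop :=
  ∃ s : Set V, Nonempty (F ≃g G.induce s)

/-! ### Two-page book embeddings are planar -/

/-- The indicator of `x < y`, with values modulo two. -/
def ltIndicator {V : Type*} [LinearOrder V] (x y : V) : ZMod 2 := if x < y then 1 else 0

theorem ltIndicator_add_swap {V : Type*} [LinearOrder V] {x y : V} (h : x ≠ y) :
    ltIndicator x y + ltIndicator y x = 1 := by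
  unfold ltIndicator
  rcases lt_or_gt_of_ne h with h | h <;> simp [h, h.le]

/-- The sum of `g u + g v` over the darts `(u, v)` of a walk which satisfy `S`. -/
def pageSum {V : Type*} {G : SimpleGraph V} (S : V → V → Prop) [DecidableRel S]
    (g : V → ZMod 2) : ∀ {u v : V}, G.Walk u v → ZMod 2
  | _, _, .nil => 0
  | u, _, .cons (v := w) _ p => (if S u w then g u + g w else 0) + pageSum S g p

section pageSum

variable {V : Type*} {G : SimpleGraph V} (S : V → V → Prop) [DecidableRel S]

theorem pageSum_add_pageSum_not (g : V → ZMod 2) {u v : V} (p : G.Walk u v) :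
    pageSum S g p + pageSum (fun x y ↦ ¬ S x y) g p = g u + g v := by
  induction p with
  | nil => simp [pageSum, CharTwo.add_self_eq_zero]
  | @cons u w v h p ih =>
    have h2 : g w + g w = 0 := CharTwo.add_self_eq_zero _
    by_cases hs : S u w <;> simp only [pageSum, hs, if_true, if_false, not_true, not_false_eq_true]
      <;> linear_combination ih + h2

theorem pageSum_add (g g' : V → ZMod 2) {u v : V} (p : G.Walk u v) :
    pageSum S (fun x ↦ g x + g' x) p = pageSum S g p + pageSum S g' p := by
  induction p with
  | nil => simp [pageSum]
  | @cons u w v h p ih =>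
    simp only [pageSum, ih]
    split_ifs <;> ring

theorem pageSum_congr {g g' : V → ZMod 2} {u v : V} (p : G.Walk u v)
    (h : ∀ x ∈ p.support, g x = g' x) : pageSum S g p = pageSum S g' p := by
  induction p with
  | nil => rfl
  | @cons u w v e p ih =>
    simp only [SimpleGraph.Walk.support_cons, List.mem_cons, forall_eq_or_imp] at h
    simp only [pageSum, ih h.2, h.1, h.2 w p.start_mem_support]

theorem pageSum_const_add (c : ZMod 2) (g : V → ZMod 2) {u v : V} (p : G.Walk u v) :
    pageSum S (fun x ↦ c + g x) p = pageSum S g p := by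
  have hc : c + c = 0 := CharTwo.add_self_eq_zero c
  induction p with
  | nil => rfl
  | @cons u w v e p ih =>
    simp only [pageSum, ih]
    split_ifs
    · linear_combination hc
    · rfl

theorem pageSum_eq_zero {g : V → ZMod 2} {u v : V} (p : G.Walk u v)
    (h : ∀ x ∈ p.support, ∀ y ∈ p.support, G.Adj x y → S x y → g x + g y = 0) :
    pageSum S g p = 0 := by
  induction p with
  | nil => rfl
  | @cons u w v e p ih =>
    simp only [pageSum]
    rw [ih fun x hx y hy ↦ h x (by simp [hx]) y (by simp [hy])]
    split_ifs with hs
    · simp [h u (by simp) w (by simp) e hs]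
    · simp

variable [LinearOrder V]

/-- No two disjoint edges on the page `S` cross when the vertices lie on the spine. -/
def PageNoncrossing (G : SimpleGraph V) (S : V → V → Prop) : Prop :=
  ∀ ⦃u x v y : V⦄, u < x → x < v → v < y → G.Adj u v → G.Adj x y → S u v → S x y → False

theorem ltIndicator_sum_eq_zero {S : V → V → Prop} (hsymm : ∀ x y, S x y → S y x)
    (hS : PageNoncrossing G S) {u v x y : V} (huv : G.Adj u v) (hxy : G.Adj x y)
    (hs : S u v) (hs' : S x y) (hux : u ≠ x) (huy : u ≠ y) (hvx : v ≠ x) (hvy : v ≠ y) :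
    ltIndicator u x + ltIndicator v x + (ltIndicator u y + ltIndicator v y) = 0 := by
  have h := hsymm _ _ hs
  have h' := hsymm _ _ hs'
  have key : ∀ a b c d : V, G.Adj a b → G.Adj c d → S a b → S c d →
      ¬ (a < c ∧ c < b ∧ b < d) :=
    fun a b c d hab hcd s s' ⟨h₁, h₂, h₃⟩ ↦ hS h₁ h₂ h₃ hab hcd s s'
  have k₁ := key u v x y huv hxy hs hs'
  have k₂ := key v u x y huv.symm hxy h hs'
  have k₃ := key u v y x huv hxy.symm hs h'
  have k₄ := key v u y x huv.symm hxy.symm h h'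
  have k₅ := key x y u v hxy huv hs' hs
  have k₆ := key x y v u hxy huv.symm hs' h
  have k₇ := key y x u v hxy.symm huv h' hs
  have k₈ := key y x v u hxy.symm huv.symm h' h
  unfold ltIndicator
  split_ifs <;> first | decide | (exfalso; grind)

theorem pageSum_pageSum_eq_zero (hsymm : ∀ x y, S x y → S y x) (hS : PageNoncrossing G S)
    {u v x y : V} (p : G.Walk u v) (q : G.Walk x y) (hd : ∀ z ∈ p.support, z ∉ q.support) :
    pageSum S (fun z ↦ pageSum S (fun t ↦ ltIndicator t z) p) q = 0 := by
  refine pageSum_eq_zero S q fun a ha b hb hab hs ↦ ?_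
  rw [← pageSum_add]
  refine pageSum_eq_zero S p fun c hc d hd' hcd hs' ↦ ?_
  have hne : ∀ z ∈ p.support, ∀ w ∈ q.support, z ≠ w := by
    rintro z hz w hw rfl
    exact hd z hz hw
  linear_combination ltIndicator_sum_eq_zero hsymm hS hcd hab hs' hs (hne c hc a ha)
    (hne c hc b hb) (hne d hd' a ha) (hne d hd' b hb)

theorem pageSum_ltIndicator_swap {u v : V} (z : V) (p : G.Walk u v) (hz : z ∉ p.support) :
    pageSum S (fun t ↦ ltIndicator z t) p = pageSum S (fun t ↦ ltIndicator t z) p := by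
  rw [← pageSum_const_add S 1 (fun t ↦ ltIndicator t z)]
  refine pageSum_congr S p fun x hx ↦ ?_
  have hxz : x ≠ z := by rintro rfl; exact hz hx
  have h2 : ltIndicator x z + ltIndicator x z = 0 := CharTwo.add_self_eq_zero _
  linear_combination ltIndicator_add_swap hxz - h2

/-- The crossing parity of two disjoint walks of a two-page embedding is even. -/
theorem crossing_parity (hsymm : ∀ x y, S x y → S y x) (hS : PageNoncrossing G S)
    (hS' : PageNoncrossing G fun x y ↦ ¬ S x y)
    {u v x y : V} (p : G.Walk u v) (q : G.Walk x y) (hd : ∀ z ∈ p.support, z ∉ q.support) :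
    pageSum S (fun t ↦ ltIndicator t x) p + pageSum S (fun t ↦ ltIndicator t y) p +
      (pageSum S (fun t ↦ ltIndicator t u) q + pageSum S (fun t ↦ ltIndicator t v) q) +
      (ltIndicator x u + ltIndicator y u + (ltIndicator x v + ltIndicator y v)) = 0 := by
  have h₁ := pageSum_pageSum_eq_zero S hsymm hS p q hd
  have h₂ := pageSum_pageSum_eq_zero (fun x y ↦ ¬ S x y) (fun x y h h' ↦ h (hsymm _ _ h')) hS'
    p q hd
  have split : ∀ z, pageSum (fun x y ↦ ¬ S x y) (fun t ↦ ltIndicator t z) p =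
      pageSum S (fun t ↦ ltIndicator t z) p + (ltIndicator u z + ltIndicator v z) := fun z ↦ by
    have h := pageSum_add_pageSum_not S (fun t ↦ ltIndicator t z) p
    have h2 := CharTwo.add_self_eq_zero (pageSum S (fun t ↦ ltIndicator t z) p)
    linear_combination h - h2
  simp only [split, pageSum_add] at h₂
  have h₃ := pageSum_add_pageSum_not S (fun z ↦ pageSum S (fun t ↦ ltIndicator t z) p) q
  rw [pageSum_ltIndicator_swap _ u q (hd u p.start_mem_support),
    pageSum_ltIndicator_swap _ v q (hd v p.end_mem_support)] at h₂
  have h₄ := pageSum_add_pageSum_not S (fun t ↦ ltIndicator t u) q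
  have h₅ := pageSum_add_pageSum_not S (fun t ↦ ltIndicator t v) q
  have two : (2 : ZMod 2) = 0 := rfl
  linear_combination h₁ + h₂ - h₃ - h₄ - h₅ + (pageSum S (fun t ↦ ltIndicator t u) q
    + pageSum S (fun t ↦ ltIndicator t v) q) * two

end pageSum

/-- The paths of a subdivision satisfy the parity identities of `crossing_parity`. -/
theorem ContainsSubdivision.exists_parity {W V : Type*} [LinearOrder V] {H : SimpleGraph W}
    {G : SimpleGraph V} (S : V → V → Prop) (hsymm : ∀ x y, S x y → S y x)
    (hS : PageNoncrossing G S) (hS' : PageNoncrossing G fun x y ↦ ¬ S x y)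
    (h : ContainsSubdivision H G) :
    ∃ (θ : W → W → ZMod 2) (β : W → W → W → ZMod 2),
      (∀ i j, i ≠ j → θ i j + θ j i = 1) ∧
      ∀ a b c d, H.Adj a b → H.Adj c d → a ≠ c → a ≠ d → b ≠ c → b ≠ d →
        β a b c + β a b d + (β c d a + β c d b) + (θ c a + θ d a + (θ c b + θ d b)) = 0 := by
  classical
  obtain ⟨f, p, -, -, hp⟩ := h
  refine ⟨fun i j ↦ ltIndicator (f i) (f j),
    fun a b c ↦ if h : H.Adj a b then pageSum S (fun t ↦ ltIndicator t (f c)) (p h) else 0,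
    fun i j hij ↦ ltIndicator_add_swap (f.injective.ne hij),
    fun a b c d hab hcd hac had hbc hbd ↦ ?_⟩
  simp only [hab, hcd, dif_pos]
  refine crossing_parity S hsymm hS hS' (p hab) (p hcd) fun z hz hz' ↦ ?_
  have hne : s(a, b) ≠ s(c, d) := by
    rw [Ne, Sym2.eq_iff]
    tauto
  obtain ⟨h₁, h₂⟩ := hp hab hcd hne z hz hz'
  rcases h₁ with rfl | rfl <;> rcases h₂ with h | h <;> exact absurd (f.injective h) ‹_›

/-- A graph with a two-page book embedding is planar. -/
theorem isPlanar_of_twoPage {V : Type*} [LinearOrder V] {G : SimpleGraph V}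
    (S : V → V → Prop) (hsymm : ∀ x y, S x y → S y x)
    (hS : PageNoncrossing G S) (hS' : PageNoncrossing G fun x y ↦ ¬ S x y) : IsPlanar G := by
  constructor
  · intro h
    obtain ⟨θ, β, hθ, hβ⟩ := h.exists_parity S hsymm hS hS'
    have key : ∀ a b c d : Fin 5,
        (_ : a ≠ b ∧ c ≠ d ∧ a ≠ c ∧ a ≠ d ∧ b ≠ c ∧ b ≠ d := by decide) →
        β a b c + β a b d + (β c d a + β c d b) + (θ c a + θ d a + (θ c b + θ d b)) = 0 :=
      fun a b c d ⟨hab, hcd, hac, had, hbc, hbd⟩ ↦ hβ a b c d hab hcd hac had hbc hbd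
    have swap : ∀ a b : Fin 5, (_ : a ≠ b := by decide) → θ a b + θ b a = 1 := hθ
    refine absurd ?_ (zero_ne_one (α := ZMod 2))
    linear_combination (norm := (ring_nf; reduce_mod_char))
      key 0 1 2 3 + key 0 1 2 4 + key 0 1 3 4 + key 0 2 1 3 + key 0 2 1 4 + key 0 2 3 4
       + key 0 3 1 2 + key 0 3 1 4 + key 0 3 2 4 + key 0 4 1 2 + key 0 4 1 3 + key 0 4 2 3
       + key 1 2 3 4 + key 1 3 2 4 + key 1 4 2 3 + swap 3 2 + swap 4 2 + swap 4 3
  · intro h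
    obtain ⟨θ, β, hθ, hβ⟩ := h.exists_parity S hsymm hS hS'
    have key : ∀ a b c d : Fin 3, (_ : a ≠ c ∧ b ≠ d := by decide) →
        β (.inl a) (.inr b) (.inl c) + β (.inl a) (.inr b) (.inr d) +
          (β (.inl c) (.inr d) (.inl a) + β (.inl c) (.inr d) (.inr b)) +
          (θ (.inl c) (.inl a) + θ (.inr d) (.inl a) +
            (θ (.inl c) (.inr b) + θ (.inr d) (.inr b))) = 0 :=
      fun a b c d ⟨hac, hbd⟩ ↦ hβ _ _ _ _ (by simp) (by simp) (by simpa using hac)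
        (by simp) (by simp) (by simpa using hbd)
    have swap : ∀ a b : Fin 3, (_ : a ≠ b := by decide) →
        θ (.inr a) (.inr b) + θ (.inr b) (.inr a) = 1 := fun a b h ↦ hθ _ _ (by simpa using h)
    refine absurd ?_ (zero_ne_one (α := ZMod 2))
    linear_combination (norm := (ring_nf; reduce_mod_char))
      key 0 0 1 1 + key 0 0 1 2 + key 0 0 2 1 + key 0 0 2 2 + key 0 1 1 0 + key 0 1 1 2
       + key 0 1 2 0 + key 0 1 2 2 + key 0 2 1 0 + key 0 2 1 1 + key 0 2 2 0 + key 0 2 2 1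
       + key 1 0 2 1 + key 1 0 2 2 + key 1 1 2 0 + key 1 1 2 2 + key 1 2 2 0 + key 1 2 2 1
       + swap 1 0 + swap 2 0 + swap 2 1

/-! ### The extremal graph -/

/-- The adjacency relation, for `u < v`, of `extremalGraph`. -/
def extremalRel (u v : ℕ) : Prop :=
  (u = 0 ∧ v ≠ 0 ∧ v ≠ 3) ∨ (u = 1 ∧ 2 ≤ v ∧ v ≠ 6) ∨
    (2 ≤ u ∧ v = u + 1 ∧ (v % 4 ≠ 0 ∨ v = 4)) ∨ (u = 2 ∧ v = 4) ∨ (u = 5 ∧ v = 7)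

instance : DecidableRel extremalRel := fun _ _ ↦ by unfold extremalRel; infer_instance

theorem extremalRel.lt {u v : ℕ} (h : extremalRel u v) : u < v := by
  unfold extremalRel at h; omega

/-- Two adjacent vertices `0` and `1` joined to disjoint paths on four vertices, together with
the vertex `3` stacked on the triangle `1, 2, 4` and the vertex `6` stacked on `0, 5, 7`. -/
def extremalGraph : SimpleGraph ℕ where
  Adj u v := extremalRel u v ∨ extremalRel v u
  symm := ⟨fun _ _ h ↦ h.symm⟩
  loopless := ⟨fun _ h ↦ by rcases h with h | h <;> exact lt_irrefl _ h.lt⟩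

theorem extremalGraph_adj {u v : ℕ} :
    extremalGraph.Adj u v ↔ extremalRel u v ∨ extremalRel v u := Iff.rfl

instance : DecidableRel extremalGraph.Adj := fun _ _ ↦ by
  unfold extremalGraph; infer_instance

/-- The restriction of `extremalGraph` to the first `n` vertices. -/
def extremalGraphFin (n : ℕ) : SimpleGraph (Fin n) := extremalGraph.comap Fin.val

theorem isPlanar_extremalGraphFin (n : ℕ) : IsPlanar (extremalGraphFin n) := by
  refine isPlanar_of_twoPage
    (fun u v ↦ u.val = 0 ∨ v.val = 0 ∨ (u.val = 2 ∧ v.val = 4) ∨ (u.val = 4 ∧ v.val = 2))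
    (fun u v h ↦ by tauto) ?_ ?_
  all_goals
    intro u x v y hux hxv hvy huv hxy hs hs'
    simp only [extremalGraphFin, comap_adj, extremalGraph_adj, extremalRel] at huv hxy
    rw [Fin.lt_def] at hux hxv hvy
    omega

set_option synthInstance.maxHeartbeats 400000 in
set_option synthInstance.maxSize 1000 in
theorem extremalGraph_no_induced_path_of_lt_eight : ∀ a b : Fin 8, 2 ≤ a.val → 2 ≤ b.val →
    extremalGraph.Adj a b →
    ∀ c : Fin 8, 2 ≤ c.val → extremalGraph.Adj b c → a ≠ c → ¬ extremalGraph.Adj a c →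
    ∀ d : Fin 8, 2 ≤ d.val → extremalGraph.Adj c d → b ≠ d → ¬ extremalGraph.Adj a d →
    ¬ extremalGraph.Adj b d →
    ∀ e : Fin 8, 2 ≤ e.val → extremalGraph.Adj d e → c ≠ e → ¬ extremalGraph.Adj a e →
    ¬ extremalGraph.Adj b e → ¬ extremalGraph.Adj c e → False := by
  decide +kernel

theorem two_le_of_not_adj_extremalGraph {x y z : ℕ} (hxy : x ≠ y) (hxz : x ≠ z) (hyz : y ≠ z)
    (h : ¬ extremalGraph.Adj x y) (h' : ¬ extremalGraph.Adj x z) : 2 ≤ x := by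
  by_contra! hx
  have zero : ∀ {t}, 0 ≠ t → ¬ extremalGraph.Adj 0 t → t = 3 := fun {t} ht h ↦
    by_contra fun ht' ↦ h (Or.inl (Or.inl ⟨rfl, ht.symm, ht'⟩))
  have one : ∀ {t}, 1 ≠ t → ¬ extremalGraph.Adj 1 t → t = 6 := fun {t} ht h ↦ by
    by_contra ht'
    rcases Nat.eq_zero_or_pos t with rfl | ht₀
    · exact h (by decide)
    · exact h (Or.inl (Or.inr (Or.inl ⟨rfl, by omega, ht'⟩)))
  interval_cases x
  · exact hyz ((zero hxy h).trans (zero hxz h').symm)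
  · exact hyz ((one hxy h).trans (one hxz h').symm)

theorem extremalGraph_block {x y : ℕ} (hx : 2 ≤ x) (hy : 2 ≤ y) (h : extremalGraph.Adj x y) :
    (x < 8 ∧ y < 8) ∨ (8 ≤ x ∧ 8 ≤ y ∧ x / 4 = y / 4) := by
  simp only [extremalGraph_adj, extremalRel] at h
  rcases h with h | h <;> rcases h with h | h | ⟨-, rfl, h | h⟩ | h | h <;> omega

theorem extremalGraph_no_induced_path {a b c d e : ℕ} (hac : a ≠ c) (had : a ≠ d) (hae : a ≠ e)
    (hbd : b ≠ d) (hbe : b ≠ e) (hce : c ≠ e)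
    (ab : extremalGraph.Adj a b) (bc : extremalGraph.Adj b c)
    (cd : extremalGraph.Adj c d) (de : extremalGraph.Adj d e)
    (ac : ¬ extremalGraph.Adj a c) (ad : ¬ extremalGraph.Adj a d) (ae : ¬ extremalGraph.Adj a e)
    (bd : ¬ extremalGraph.Adj b d) (be : ¬ extremalGraph.Adj b e)
    (ce : ¬ extremalGraph.Adj c e) : False := by
  have ha := two_le_of_not_adj_extremalGraph hac had (fun h ↦ extremalGraph.irrefl (h ▸ cd)) ac ad
  have hb := two_le_of_not_adj_extremalGraph hbd hbe (fun h ↦ extremalGraph.irrefl (h ▸ de)) bd be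
  have hc := two_le_of_not_adj_extremalGraph hac.symm hce hae (fun h ↦ ac h.symm) ce
  have hd := two_le_of_not_adj_extremalGraph had.symm hbd.symm (fun h ↦ extremalGraph.irrefl (h ▸ ab))
    (fun h ↦ ad h.symm) (fun h ↦ bd h.symm)
  have he := two_le_of_not_adj_extremalGraph hae.symm hbe.symm (fun h ↦ extremalGraph.irrefl (h ▸ ab))
    (fun h ↦ ae h.symm) (fun h ↦ be h.symm)
  have h₁ := extremalGraph_block ha hb ab
  have h₂ := extremalGraph_block hb hc bc
  have h₃ := extremalGraph_block hc hd cd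
  have h₄ := extremalGraph_block hd he de
  have := ab.ne
  have := bc.ne
  have := cd.ne
  have := de.ne
  by_cases h8 : 8 ≤ a
  · omega
  · exact extremalGraph_no_induced_path_of_lt_eight ⟨a, by omega⟩ ⟨b, by omega⟩ ha hb ab
      ⟨c, by omega⟩ hc bc (by simpa using hac) ac
      ⟨d, by omega⟩ hd cd (by simpa using hbd) ad bd ⟨e, by omega⟩ he de (by simpa using hce)
      ae be ce

theorem not_containsInduced_extremalGraphFin (n : ℕ) :
    ¬ ContainsInduced (pathGraph 5) (extremalGraphFin n) := by
  rintro ⟨s, ⟨φ⟩⟩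
  have hadj : ∀ i j : Fin 5, extremalGraph.Adj (φ i).1.val (φ j).1.val ↔ (pathGraph 5).Adj i j :=
    fun i j ↦ φ.map_adj_iff
  have hne : ∀ i j : Fin 5, i ≠ j → (φ i).1.val ≠ (φ j).1.val := fun i j hij h ↦
    hij (φ.injective (Subtype.ext (Fin.ext h)))
  simp only [pathGraph_adj] at hadj
  apply extremalGraph_no_induced_path (hne 0 2 (by decide)) (hne 0 3 (by decide))
    (hne 0 4 (by decide)) (hne 1 3 (by decide)) (hne 1 4 (by decide)) (hne 2 4 (by decide)) <;>
  · rw [hadj]; decide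

theorem card_filter_extremalRel {v : ℕ} (hv : 8 ≤ v) :
    ((Finset.range v).filter (extremalRel · v)).card = if v % 4 = 0 then 2 else 3 := by
  split_ifs with h
  · have : (Finset.range v).filter (extremalRel · v) = {0, 1} := by
      ext u
      rw [Finset.mem_filter, Finset.mem_range]
      simp only [Finset.mem_insert, Finset.mem_singleton, extremalRel]
      omega
    rw [this]
    rfl
  · have : (Finset.range v).filter (extremalRel · v) = {0, 1, v - 1} := by
      ext u
      rw [Finset.mem_filter, Finset.mem_range]
      simp only [Finset.mem_insert, Finset.mem_singleton, extremalRel]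
      omega
    rw [this, Finset.card_eq_three]
    exact ⟨0, 1, v - 1, by omega, by omega, by omega, rfl⟩

theorem sum_card_filter_extremalRel {n : ℕ} (hn : 8 ≤ n) :
    ∑ v ∈ Finset.range n, ((Finset.range v).filter (extremalRel · v)).card = 11 * n / 4 - 4 := by
  induction n, hn using Nat.le_induction with
  | base => decide
  | succ n hn ih =>
    rw [Finset.sum_range_succ, ih, card_filter_extremalRel hn]
    obtain ⟨c, rfl | rfl | rfl | rfl⟩ : ∃ c, n = 4 * c ∨ n = 4 * c + 1 ∨ n = 4 * c + 2 ∨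
        n = 4 * c + 3 := ⟨n / 4, by omega⟩ <;> split_ifs <;> omega

theorem ncard_edgeSet_extremalGraphFin (n : ℕ) :
    (extremalGraphFin n).edgeSet.ncard =
      ∑ v ∈ Finset.range n, ((Finset.range v).filter (extremalRel · v)).card := by
  rw [← Finset.card_sigma, ← Set.ncard_coe_finset]
  symm
  refine Set.ncard_congr (fun x hx ↦ s(⟨x.2, ?_⟩, ⟨x.1, ?_⟩)) ?_ ?_ ?_
  · simp only [Finset.coe_sigma, Set.mem_sigma_iff, Finset.mem_coe, Finset.mem_range,
      Finset.mem_filter] at hx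
    omega
  · simp only [Finset.coe_sigma, Set.mem_sigma_iff, Finset.mem_coe, Finset.mem_range] at hx
    omega
  · rintro ⟨v, u⟩ h
    simp only [Finset.coe_sigma, Set.mem_sigma_iff, Finset.mem_coe, Finset.mem_range,
      Finset.mem_filter] at h
    exact Or.inl h.2.2
  · rintro ⟨v, u⟩ ⟨v', u'⟩ h h' heq
    simp only [Finset.coe_sigma, Set.mem_sigma_iff, Finset.mem_coe, Finset.mem_range,
      Finset.mem_filter] at h h'
    simp only [Sym2.eq_iff, Fin.mk.injEq] at heq
    obtain ⟨rfl, rfl⟩ : u = u' ∧ v = v' := by omega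
    rfl
  · intro e he
    induction e with
    | _ u v =>
      have main : ∀ u v : Fin n, extremalRel u v → ∃ (a : Σ _ : ℕ, ℕ)
          (ha : a ∈ (((Finset.range n).sigma fun v ↦
            (Finset.range v).filter (extremalRel · v) : Finset (Σ _ : ℕ, ℕ)) : Set (Σ _ : ℕ, ℕ))),
          a.2 = u.val ∧ a.1 = v.val := fun u v h ↦
        ⟨⟨v, u⟩, by simp [h, h.lt], rfl, rfl⟩
      rcases he with h | h
      · obtain ⟨a, ha, h₁, h₂⟩ := main u v h
        exact ⟨a, ha, by simp [h₁, h₂]⟩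
      · obtain ⟨a, ha, h₁, h₂⟩ := main v u h
        exact ⟨a, ha, by simp [h₁, h₂, Sym2.eq_swap]⟩

theorem stmt_19 (n : ℕ) (hn : 9 ≤ n) :
    ∃ G : SimpleGraph (Fin n), IsPlanar G ∧ ¬ ContainsInduced (pathGraph 5) G ∧
      G.edgeSet.ncard = 11 * n / 4 - 4 :=
  ⟨extremalGraphFin n, isPlanar_extremalGraphFin n, not_containsInduced_extremalGraphFin n, by
    rw [ncard_edgeSet_extremalGraphFin, sum_card_filter_extremalRel (by omega)]⟩
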